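/- Let G=(V,E) be a digraph with E nonempty and unit capacities cap(e) = 1 for all e ∈ E, and let α be rational with 0 < α < 1 and α ≤ 1/|E|. Then a set A ⊆ E is a feasible MMCFS solution for (G,cap,α) if and only if for every edge (s,t) ∈ E there exists a directed path from s to t using only edges of A. (Hence the optimal MMCFS solutions are exactly the minimum equivalent digraphs of G.) -/

import Mathlib

open Finset

variable {V : Type*}

/-- A flow for the commodity `(s,t)` of value `d`, supported on the edge set `E`. -/
def IsFlow [Fintype V] [DecidableEq V] (E : Finset (V × V)) (s t : V) (d : ℚ)
    (f : V × V → ℚ) : Prop :=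
  (∀ e, 0 ≤ f e) ∧ (∀ e, e ∉ E → f e = 0) ∧
    ∀ v : V,
      ((∑ e ∈ E.filter (fun e => e.2 = v), f e) -
          ∑ e ∈ E.filter (fun e => e.1 = v), f e) =
        (if v = t then d else 0) - (if v = s then d else 0)

/-- The traffic matrix `T` is routable in the edge set `A ⊆ E` via a multi-commodity flow. -/
def Routable [Fintype V] [DecidableEq V] (E : Finset (V × V)) (cap : V × V → ℚ)
    (T : V × V → ℚ) (A : Finset (V × V)) : Prop :=
  ∃ f : V × V → V × V → ℚ,
    (∀ p : V × V, IsFlow E p.1 p.2 (T p) (f p)) ∧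
    (∀ e ∈ E, (∑ p : V × V, f p e) ≤ cap e) ∧
    (∀ e ∈ E, e ∉ A → (∑ p : V × V, f p e) = 0)

/-- The traffic matrix `T_E` demanding `cap e` for each edge `e ∈ E` and `0` otherwise. -/
def trafficTE [Fintype V] [DecidableEq V] (E : Finset (V × V)) (cap : V × V → ℚ) :
    V × V → ℚ := fun p => if p ∈ E then cap p else 0

/-- A traffic matrix is a nonnegative function on pairs of vertices. -/
def IsTrafficMatrix (T : V × V → ℚ) : Prop := ∀ p, 0 ≤ T p

/-- A walk from `s` to `t` either is trivial or can be cut after its last departure from `s`. -/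
lemma reflTransGen_last_departure {R : V → V → Prop} {s t : V}
    (h : Relation.ReflTransGen R s t) :
    s = t ∨ ∃ u, R s u ∧ Relation.ReflTransGen (fun a b => R a b ∧ a ≠ s) u t := by
  induction h with
  | refl => exact Or.inl rfl
  | @tail b c _ hbc ih =>
    right
    by_cases hb : b = s
    · subst hb
      exact ⟨c, hbc, .refl⟩
    · obtain rfl | ⟨u, hu, hut⟩ := ih
      · exact absurd rfl hb
      · exact ⟨u, hu, hut.tail ⟨hbc, hb⟩⟩

lemma isFlow_single [Fintype V] [DecidableEq V] {E : Finset (V × V)} {p : V × V} (hp : p ∈ E)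
    {d : ℚ} (hd : 0 ≤ d) : IsFlow E p.1 p.2 d (Pi.single p d) := by
  refine ⟨fun e => ?_, fun e he => ?_, fun v => ?_⟩
  · by_cases h : e = p <;> simp [h, hd]
  · simp [(ne_of_mem_of_not_mem hp he).symm]
  · simp [Pi.single_apply, hp, eq_comm]

lemma isFlow_zero [Fintype V] [DecidableEq V] (E : Finset (V × V)) (s t : V) :
    IsFlow E s t 0 0 := by
  simp [IsFlow]

/-- If `t` is reachable from `s` in `B`, a unit of flow can be sent along a path in `B`, using each
edge at most once. -/
lemma exists_unit_flow_of_reflTransGen [Fintype V] [DecidableEq V] {E : Finset (V × V)}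
    (B : Finset (V × V)) (hB : B ⊆ E) (s t : V)
    (h : Relation.ReflTransGen (fun u v : V => (u, v) ∈ B) s t) :
    ∃ f : V × V → ℚ, IsFlow E s t 1 f ∧ (∀ e, f e ≤ 1) ∧ ∀ e, e ∉ B → f e = 0 := by
  induction B using Finset.strongInduction generalizing s with
  | H B ih =>
    obtain rfl | ⟨u, hsu, hut⟩ := reflTransGen_last_departure h
    · exact ⟨0, by simp [IsFlow], by simp, by simp⟩
    · obtain ⟨g, ⟨hg0, hgE, hgv⟩, hg1, hgB⟩ := ih (B.filter fun e => e.1 ≠ s)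
        (Finset.filter_ssubset.2 ⟨(s, u), hsu, by simp⟩)
        ((Finset.filter_subset _ _).trans hB) u (by simpa using hut)
      obtain ⟨hk0, hkE, hkv⟩ := isFlow_single (hB hsu) zero_le_one
      have hgs : g (s, u) = 0 := hgB _ (by simp)
      refine ⟨g + Pi.single (s, u) 1, ⟨fun e => add_nonneg (hg0 e) (hk0 e), fun e he => ?_,
        fun v => ?_⟩, fun e => ?_, fun e he => ?_⟩
      · simp [hgE e he, hkE e he]
      · have h₁ := hgv v
        have h₂ := hkv v
        simp only [Pi.add_apply, Finset.sum_add_distrib]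
        linarith
      · by_cases he : e = (s, u)
        · simp [he, hgs]
        · simpa [Pi.single_apply, he] using hg1 e
      · have hne : e ≠ (s, u) := by
          rintro rfl
          exact he hsu
        simpa [Pi.single_apply, hne] using hgB e fun h => he (Finset.mem_filter.1 h).1

/-- A flow of positive value supported on `A` certifies a path in `A`. -/
lemma IsFlow.reflTransGen [Fintype V] [DecidableEq V] {E A : Finset (V × V)} {s t : V} {d : ℚ}
    {f : V × V → ℚ} (hf : IsFlow E s t d f) (hd : 0 < d)
    (hA : ∀ e ∈ E, e ∉ A → f e = 0) :
    Relation.ReflTransGen (fun u v : V => (u, v) ∈ A) s t := by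
  classical
  by_contra hst
  obtain ⟨hf0, -, hfv⟩ := hf
  set R : Finset V := Finset.univ.filter
    fun v => Relation.ReflTransGen (fun u v : V => (u, v) ∈ A) s v with hR
  have hs : s ∈ R := by simp [hR, Relation.ReflTransGen.refl]
  have ht : t ∉ R := by simpa [hR] using hst
  have hsum := Finset.sum_congr (rfl : R = R) fun v _ => hfv v
  simp only [Finset.sum_sub_distrib, Finset.sum_filter, Finset.sum_ite_eq', hs, ht, if_true,
    if_false] at hsum
  rw [Finset.sum_comm, Finset.sum_comm (s := R)] at hsum
  simp only [Finset.sum_ite_eq] at hsum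
  have hle : (∑ e ∈ E, if e.1 ∈ R then f e else 0) ≤ ∑ e ∈ E, if e.2 ∈ R then f e else 0 := by
    refine Finset.sum_le_sum fun e he => ?_
    by_cases h1 : e.1 ∈ R
    · by_cases heA : e ∈ A
      · have h2 : e.2 ∈ R := by
          simp only [hR, Finset.mem_filter, Finset.mem_univ, true_and] at h1 ⊢
          exact h1.tail heA
        simp [h1, h2]
      · simp [hA e he heA]
    · rw [if_neg h1]
      split_ifs
      exacts [hf0 e, le_rfl]
  linarith

/-- Rerouting every edge of a flow along a unit flow between the ends of that edge. -/
lemma IsFlow.reroute [Fintype V] [DecidableEq V] {E : Finset (V × V)} {s t : V} {d α : ℚ}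
    {f : V × V → ℚ} {g : V × V → V × V → ℚ} (hα : 0 ≤ α) (hf : IsFlow E s t d f)
    (hg : ∀ e ∈ E, IsFlow E e.1 e.2 1 (g e)) :
    IsFlow E s t (α * d) fun e => α * ∑ e' ∈ E, f e' * g e' e := by
  obtain ⟨hf0, -, hfv⟩ := hf
  refine ⟨fun e => mul_nonneg hα (Finset.sum_nonneg fun e' he' =>
    mul_nonneg (hf0 e') ((hg e' he').1 e)), fun e he => ?_, fun v => ?_⟩
  · exact mul_eq_zero_of_right α <| Finset.sum_eq_zero fun e' he' =>
      mul_eq_zero_of_right _ ((hg e' he').2.1 e he)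
  · rw [← Finset.mul_sum, ← Finset.mul_sum, Finset.sum_comm, Finset.sum_comm (t := E),
      ← mul_sub, ← Finset.sum_sub_distrib]
    simp only [← Finset.mul_sum, ← mul_sub]
    rw [Finset.sum_congr rfl fun e' he' => by rw [(hg e' he').2.2 v]]
    have h := hfv v
    simp only [Finset.sum_filter] at h
    simp only [mul_sub, mul_ite, mul_one, mul_zero, Finset.sum_sub_distrib, eq_comm (a := v)] at h ⊢
    rw [← mul_sub, h]
    simp only [mul_sub, mul_ite, mul_zero]

lemma routable_trafficTE [Fintype V] [DecidableEq V] (E : Finset (V × V)) (cap : V × V → ℚ)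
    (hcap : ∀ e ∈ E, 0 ≤ cap e) : Routable E cap (trafficTE E cap) E := by
  refine ⟨fun p => Pi.single p (trafficTE E cap p), fun p => ?_, fun e he => ?_,
    fun e he h => absurd he h⟩
  · by_cases hp : p ∈ E
    · exact isFlow_single hp (by simpa [trafficTE, hp] using hcap p hp)
    · simpa [trafficTE, hp] using isFlow_zero E p.1 p.2
  · simp [Pi.single_apply, trafficTE, he]

theorem stmt6 [Fintype V] [DecidableEq V] (E : Finset (V × V)) (hne : E.Nonempty)
    (hE : ∀ e ∈ E, e.1 ≠ e.2) (cap : V × V → ℚ) (hcap : ∀ e ∈ E, cap e = 1)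
    (α : ℚ) (h0 : 0 < α) (h1 : α < 1) (hαE : α ≤ 1 / (E.card : ℚ))
    (A : Finset (V × V)) (hA : A ⊆ E) :
    (∀ T : V × V → ℚ, IsTrafficMatrix T → Routable E cap T E →
        Routable E cap (fun p => α * T p) A) ↔
      ∀ e ∈ E, Relation.ReflTransGen (fun u v : V => (u, v) ∈ A) e.1 e.2 := by
  constructor
  · intro h e he
    have hcap0 : ∀ e ∈ E, 0 ≤ cap e := fun e he => by simp [hcap e he]
    obtain ⟨f, hf, -, hfA⟩ := h (trafficTE E cap)
      (fun p => by
        by_cases hp : p ∈ E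
        · simpa [trafficTE, hp] using hcap0 p hp
        · simp [trafficTE, hp])
      (routable_trafficTE E cap hcap0)
    refine (hf e).reflTransGen (by simpa [trafficTE, he, hcap e he] using h0) fun e' he' hA' => ?_
    exact (Finset.sum_eq_zero_iff_of_nonneg fun p _ => (hf p).1 e').1 (hfA e' he' hA') e
      (Finset.mem_univ e)
  · rintro h T - ⟨f, hf, hfcap, -⟩
    have key : ∀ e, ∃ g : V × V → ℚ, e ∈ E →
        IsFlow E e.1 e.2 1 g ∧ (∀ e', g e' ≤ 1) ∧ ∀ e', e' ∉ A → g e' = 0 := fun e => by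
      by_cases he : e ∈ E
      · obtain ⟨g, hg⟩ := exists_unit_flow_of_reflTransGen A hA e.1 e.2 (h e he)
        exact ⟨g, fun _ => hg⟩
      · exact ⟨0, fun h => absurd h he⟩
    choose g hg using key
    refine ⟨fun p e => α * ∑ e' ∈ E, f p e' * g e' e,
      fun p => (hf p).reroute h0.le fun e he => (hg e he).1, fun e he => ?_, fun e he heA => ?_⟩
    · have hle : ∑ e' ∈ E, (∑ p, f p e') * g e' e ≤ ∑ e' ∈ E, (1 : ℚ) :=
        Finset.sum_le_sum fun e' he' => mul_le_one₀ ((hfcap e' he').trans_eq (hcap e' he'))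
          ((hg e' he').1.1 e) ((hg e' he').2.1 e)
      have hcard : (0 : ℚ) < E.card := by exact_mod_cast hne.card_pos
      rw [← Finset.mul_sum, Finset.sum_comm, hcap e he]
      simp only [← Finset.sum_mul]
      calc α * ∑ e' ∈ E, (∑ p, f p e') * g e' e ≤ α * E.card :=
            mul_le_mul_of_nonneg_left (by simpa using hle) h0.le
        _ ≤ 1 := (le_div_iff₀ hcard).1 hαE
    · exact Finset.sum_eq_zero fun p _ => mul_eq_zero_of_right α <| Finset.sum_eq_zero fun e' he' =>
        mul_eq_zero_of_right _ ((hg e' he').2.2 e heA)
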